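/- arXiv:1911.05846 — 3 statements merged into one kernel-verified Lean document; each statement's English description precedes it below -/
import Mathlib

section
/- Let n ≥ 2 be an integer. Over all real n×n matrices Φ with every entry in [0,1] that satisfy Φ_{i,i} = 1 for all i ∈ {1,…,n} and Φ_{i,j} = 1 − Φ_{j,i} for all pairs i ≠ j, the maximum of the quantity ∑_{j=1}^n ∏_{i=1}^n Φ_{i,j} equals 1. That is, every such matrix satisfies ∑_{j=1}^n ∏_{i=1}^n Φ_{i,j} ≤ 1, and there exists such a matrix for which ∑_{j=1}^n ∏_{i=1}^n Φ_{i,j} = 1. -/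
open Finset

theorem aux_le {n : ℕ} (Φ : Matrix (Fin n) (Fin n) ℝ)
    (h : ∀ i j, Φ i j ∈ Set.Icc (0 : ℝ) 1) (hd : ∀ i, Φ i i = 1)
    (hs : ∀ i j, i ≠ j → Φ i j = 1 - Φ j i) (s : Finset (Fin n)) :
    ∑ j ∈ s, ∏ i ∈ s, Φ i j ≤ 1 := by
  induction s using Finset.induction_on with
  | empty => simp
  | insert a s ha ih =>
    rw [Finset.sum_insert ha, Finset.prod_insert ha, hd, one_mul]
    have e : ∀ j ∈ s, ∏ i ∈ insert a s, Φ i j = Φ a j * ∏ i ∈ s, Φ i j :=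
      fun j _ => Finset.prod_insert ha
    rw [Finset.sum_congr rfl e]
    rcases s.eq_empty_or_nonempty with rfl | hne
    · simp
    obtain ⟨m, hm, hmax⟩ := Finset.exists_max_image s (fun j => Φ a j) hne
    have h1 : ∑ j ∈ s, Φ a j * ∏ i ∈ s, Φ i j ≤ Φ a m := by
      calc ∑ j ∈ s, Φ a j * ∏ i ∈ s, Φ i j
          ≤ ∑ j ∈ s, Φ a m * ∏ i ∈ s, Φ i j :=
            Finset.sum_le_sum fun j hj => mul_le_mul_of_nonneg_right (hmax j hj)
              (Finset.prod_nonneg fun i _ => (h i j).1)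
        _ = Φ a m * ∑ j ∈ s, ∏ i ∈ s, Φ i j := by rw [Finset.mul_sum]
        _ ≤ Φ a m := mul_le_of_le_one_right (h a m).1 ih
    have h2 : ∏ i ∈ s, Φ i a ≤ Φ m a := by
      rw [← Finset.mul_prod_erase s _ hm]
      exact mul_le_of_le_one_right (h m a).1
        (Finset.prod_le_one (fun i _ => (h i a).1) (fun i _ => (h i a).2))
    have hma : m ≠ a := fun e => ha (e ▸ hm)
    have := hs m a hma
    linarith

/-- The maximum of `∑ j, ∏ i, Φ i j` over feasible matrices (entries in `[0,1]`,
unit diagonal, `Φ i j = 1 - Φ j i` for `i ≠ j`) equals `1`. -/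
theorem stmt_0 (n : ℕ) (hn : 2 ≤ n) :
    (∀ Φ : Matrix (Fin n) (Fin n) ℝ,
        (∀ i j, Φ i j ∈ Set.Icc (0 : ℝ) 1) →
        (∀ i, Φ i i = 1) →
        (∀ i j, i ≠ j → Φ i j = 1 - Φ j i) →
        ∑ j, ∏ i, Φ i j ≤ 1) ∧
    (∃ Φ : Matrix (Fin n) (Fin n) ℝ,
        (∀ i j, Φ i j ∈ Set.Icc (0 : ℝ) 1) ∧
        (∀ i, Φ i i = 1) ∧
        (∀ i j, i ≠ j → Φ i j = 1 - Φ j i) ∧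
        ∑ j, ∏ i, Φ i j = 1) := by
  refine ⟨fun Φ h hd hs => aux_le Φ h hd hs Finset.univ, fun i j => if i ≤ j then 1 else 0,
    ?_, ?_, ?_, ?_⟩
  · intro i j
    dsimp only
    split_ifs <;> simp
  · intro i
    simp
  · intro i j hij
    dsimp only
    rcases lt_or_gt_of_ne hij with h | h
    · simp [h.le, not_le.mpr h]
    · simp [h.le, not_le.mpr h]
  · rw [Finset.sum_eq_single (⟨n - 1, by omega⟩ : Fin n)]
    · apply Finset.prod_eq_one
      intro i _
      dsimp only
      rw [if_pos]
      rw [Fin.le_def]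
      have := i.2
      dsimp only
      omega
    · intro j _ hj
      apply Finset.prod_eq_zero (Finset.mem_univ (⟨n - 1, by omega⟩ : Fin n))
      dsimp only
      rw [if_neg]
      intro hle
      apply hj
      rw [Fin.le_def] at hle
      have := j.2
      ext
      dsimp only at hle ⊢
      omega
    · intro h
      exact absurd (Finset.mem_univ _) h
end

section
/- Let μ ∈ ℝ, let σ_x, σ_y > 0, and let X and Y be independent real random variables on a probability space with X distributed as the Gaussian law 𝒩(μ, σ_x²) and Y distributed as 𝒩(μ, σ_y²). Let Φ denote the cumulative distribution function of 𝒩(0,1) and define the random variable p = Φ( (X − Y) / √(σ_x² + σ_y²) ). Then for every ε ∈ [0, 0.5], ℙ( p > 0.5 + ε ) = 0.5 − ε and ℙ( p < 0.5 − ε ) = 0.5 − ε. -/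
open MeasureTheory ProbabilityTheory
open scoped ProbabilityTheory

/-- The cumulative distribution function of the standard normal law `𝒩(0,1)`. -/
noncomputable def stdNormalCDF (t : ℝ) : ℝ :=
  ((gaussianReal 0 1) (Set.Iic t)).toReal

lemma std_eq_cdf (t : ℝ) : stdNormalCDF t = cdf (gaussianReal 0 1) t := by
  rw [cdf_eq_real]; rfl

lemma ofReal_std (t : ℝ) : ENNReal.ofReal (stdNormalCDF t) = gaussianReal 0 1 (Set.Iic t) := by
  rw [std_eq_cdf, ofReal_cdf]

lemma std_strictMono : StrictMono stdNormalCDF := by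
  intro a b hab
  have h0 : gaussianReal 0 1 (Set.Ioc a b) ≠ 0 := by
    intro h
    have := gaussianReal_absolutelyContinuous' 0 (one_ne_zero) h
    simp at this
    linarith
  rw [← measure_cdf (gaussianReal 0 1), StieltjesFunction.measure_Ioc] at h0
  rw [std_eq_cdf, std_eq_cdf]
  simpa using h0

lemma std_continuous : Continuous stdNormalCDF := by
  have e : stdNormalCDF = cdf (gaussianReal 0 1) := funext std_eq_cdf
  rw [e, continuous_iff_continuousAt]
  intro a
  have hm := monotone_cdf (gaussianReal 0 1)
  rw [hm.continuousAt_iff_leftLim_eq_rightLim, StieltjesFunction.rightLim_eq]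
  apply le_antisymm (hm.leftLim_le le_rfl)
  have := nullSingletonClass_gaussianReal (μ := 0) (v := 1) one_ne_zero
  have h0 : gaussianReal 0 1 {a} = 0 := measure_singleton a
  rw [← measure_cdf (gaussianReal 0 1), StieltjesFunction.measure_singleton] at h0
  simpa using h0

lemma std_pos (t : ℝ) : 0 < stdNormalCDF t :=
  lt_of_le_of_lt (by rw [std_eq_cdf]; exact cdf_nonneg _ _) (std_strictMono (sub_one_lt t))

lemma std_lt_one (t : ℝ) : stdNormalCDF t < 1 :=
  lt_of_lt_of_le (std_strictMono (lt_add_one t)) (by rw [std_eq_cdf]; exact cdf_le_one _ _)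

lemma std_surj (c : ℝ) (h0 : 0 < c) (h1 : c < 1) : ∃ t, stdNormalCDF t = c := by
  have e : stdNormalCDF = cdf (gaussianReal 0 1) := funext std_eq_cdf
  refine mem_range_of_exists_le_of_exists_ge std_continuous ?_ ?_
  · rw [e]
    exact ((tendsto_cdf_atBot (gaussianReal 0 1)).eventually (eventually_le_nhds h0)).exists
  · rw [e]
    exact ((tendsto_cdf_atTop (gaussianReal 0 1)).eventually (eventually_ge_nhds h1)).exists

lemma std_lt (c : ℝ) (h0 : 0 ≤ c) (h1 : c < 1) :
    gaussianReal 0 1 {t | stdNormalCDF t < c} = ENNReal.ofReal c := by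
  rcases h0.eq_or_lt with rfl | h0
  · simp [(std_pos _).not_gt]
  obtain ⟨s, rfl⟩ := std_surj c h0 h1
  have := nullSingletonClass_gaussianReal (μ := 0) (v := 1) one_ne_zero
  simp only [std_strictMono.lt_iff_lt]
  rw [ofReal_std]
  exact measure_congr Iio_ae_eq_Iic

lemma std_gt (c : ℝ) (h0 : 0 < c) (h1 : c ≤ 1) :
    gaussianReal 0 1 {t | c < stdNormalCDF t} = ENNReal.ofReal (1 - c) := by
  rcases h1.eq_or_lt with rfl | h1
  · simp [(std_lt_one _).not_gt]
  obtain ⟨s, rfl⟩ := std_surj c h0 h1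
  simp only [std_strictMono.lt_iff_lt]
  rw [ENNReal.ofReal_sub _ h0.le, ofReal_std, ENNReal.ofReal_one,
    ← prob_compl_eq_one_sub measurableSet_Iic, Set.compl_Iic]
  rfl

/-- If `X ~ 𝒩(μ, σx²)` and `Y ~ 𝒩(μ, σy²)` are independent, then the p-value
`p = Φ((X - Y)/√(σx² + σy²))` satisfies `ℙ(p > 0.5 + ε) = ℙ(p < 0.5 - ε) = 0.5 - ε`
for every `ε ∈ [0, 0.5]`. -/
theorem stmt_7 {Ω : Type*} [MeasureSpace Ω] [IsProbabilityMeasure (ℙ : Measure Ω)]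
    (μ : ℝ) (σx σy : ℝ) (hσx : 0 < σx) (hσy : 0 < σy)
    (X Y : Ω → ℝ) (hindep : IndepFun X Y ℙ)
    (hX : Measure.map X ℙ = gaussianReal μ ⟨σx ^ 2, sq_nonneg σx⟩)
    (hY : Measure.map Y ℙ = gaussianReal μ ⟨σy ^ 2, sq_nonneg σy⟩) :
    ∀ ε : ℝ, ε ∈ Set.Icc (0 : ℝ) 0.5 →
      ℙ {ω : Ω | stdNormalCDF ((X ω - Y ω) / Real.sqrt (σx ^ 2 + σy ^ 2))
            > 0.5 + ε} = ENNReal.ofReal (0.5 - ε) ∧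
      ℙ {ω : Ω | stdNormalCDF ((X ω - Y ω) / Real.sqrt (σx ^ 2 + σy ^ 2))
            < 0.5 - ε} = ENNReal.ofReal (0.5 - ε) := by
  intro ε hε
  obtain ⟨h0, h1⟩ := hε
  have mX : AEMeasurable X ℙ := by
    apply AEMeasurable.of_map_ne_zero; rw [hX]; exact (instIsProbabilityMeasureGaussianReal μ _).ne_zero
  have mY : AEMeasurable Y ℙ := by
    apply AEMeasurable.of_map_ne_zero; rw [hY]; exact (instIsProbabilityMeasureGaussianReal μ _).ne_zero
  have hnY := gaussianReal_neg (⟨mY, hY⟩ : HasLaw Y _ ℙ)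
  have hi : IndepFun X (-Y) ℙ := hindep.comp measurable_id measurable_neg
  have hs : HasLaw (X + -Y) _ ℙ :=
    ⟨mX.add mY.neg, gaussianReal_add_gaussianReal_of_indepFun hi hX hnY.map_eq⟩
  have hZ := gaussianReal_div_const hs (Real.sqrt (σx ^ 2 + σy ^ 2))
  have hp : 0 < σx ^ 2 + σy ^ 2 := by positivity
  have hZ' : HasLaw (fun ω => (X ω - Y ω) / Real.sqrt (σx ^ 2 + σy ^ 2))
      (gaussianReal 0 1) ℙ := by
    convert hZ using 2
    · simp [sub_eq_add_neg]
    · simp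
    · ext
      simp only [NNReal.coe_div, NNReal.coe_add, NNReal.coe_mk, NNReal.coe_one]
      rw [Real.sq_sqrt hp.le]
      exact (div_self hp.ne').symm
  have hmeas := std_continuous.measurable
  constructor
  · have := hZ'.measure_eq (p := fun t => 0.5 + ε < stdNormalCDF t)
      (measurableSet_lt measurable_const hmeas)
    rw [std_gt _ (by linarith) (by linarith)] at this
    convert this using 2
    ring
  · have := hZ'.measure_eq (p := fun t => stdNormalCDF t < 0.5 - ε)
      (measurableSet_lt hmeas measurable_const)
    rw [std_lt _ (by linarith) (by linarith)] at this
    exact this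
end

section
/- Let μ ∈ ℝ and σ_max > 0, and let (σ_i)_{i≥1} be a sequence of positive reals with σ_i ≤ σ_max for all i. Let (X_i)_{i≥1} be a sequence of independent real random variables with X_i distributed as the Gaussian law 𝒩(μ, σ_i²). Define for each k ≥ 1 the estimate f^k = ( ∑_{i=1}^k X_i/σ_i² ) / ( ∑_{i=1}^k 1/σ_i² ). Then ℙ( f^k → μ as k → ∞ ) = 1; that is, the precision-weighted maximum-likelihood estimates converge almost surely to the true mean. -/
open MeasureTheory ProbabilityTheory Filter Finset
open scoped ProbabilityTheory

lemma aux_subG {Ω : Type*} [MeasurableSpace Ω] {P : Measure Ω} {Y : Ω → ℝ} {v : NNReal}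
    (h : HasLaw Y (gaussianReal 0 v) P) : HasSubgaussianMGF Y v P := by
  rw [← HasSubgaussianMGF.id_map_iff h.aemeasurable, h.map_eq]
  refine ⟨fun t => integrable_exp_mul_gaussianReal t, fun t => ?_⟩
  rw [mgf_id_gaussianReal]
  simp

lemma aux_tail {Ω : Type*} [MeasurableSpace Ω] {P : Measure Ω} [IsProbabilityMeasure P]
    {S : ℕ → Ω → ℝ} {c : ℕ → NNReal} {a : ℝ} (ha : 0 < a)
    (hS : ∀ k, HasSubgaussianMGF (S k) (c k) P) (hc : ∀ k : ℕ, k * a ≤ c k)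
    {ε : ℝ} (hε : 0 < ε) : ∀ᵐ ω ∂P, ∀ᶠ k in atTop, S k ω < ε * c k := by
  have key : ∀ k, P.real {ω | ε * c k ≤ S k ω} ≤ Real.exp (k * (-(ε ^ 2 * a / 2))) := by
    intro k
    refine ((hS k).measure_ge_le (by positivity)).trans (Real.exp_le_exp.2 ?_)
    have h1 := hc k
    rcases eq_or_ne (c k : ℝ) 0 with h0 | h0
    · rw [h0] at h1 ⊢
      have hk : (k : ℝ) = 0 := le_antisymm (by nlinarith) (Nat.cast_nonneg k)
      simp [hk]
    · have : -(ε * (c k : ℝ)) ^ 2 / (2 * c k) = -(ε ^ 2 * c k / 2) := by field_simp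
      rw [this]
      nlinarith [mul_le_mul_of_nonneg_left h1 (sq_nonneg ε)]
  have hsum : Summable fun k : ℕ => Real.exp (k * (-(ε ^ 2 * a / 2))) := by
    apply Real.summable_exp_nat_mul_iff.2
    have : 0 < ε ^ 2 * a := by positivity
    linarith
  have hs2 : Summable fun k => P.real {ω | ε * c k ≤ S k ω} :=
    Summable.of_nonneg_of_le (fun _ => measureReal_nonneg) key hsum
  have hne : (∑' k, P {ω | ε * c k ≤ S k ω}) ≠ ⊤ := by
    have := hs2.tsum_ofReal_ne_top
    simpa [measureReal_def] using this
  filter_upwards [ae_eventually_notMem hne] with ω hω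
  filter_upwards [hω] with k hk
  simpa using hk

/-- If `(X_i)` are independent with `X_i ~ 𝒩(μ, σ_i²)` and the `σ_i` are uniformly
bounded by `σmax`, then the precision-weighted maximum-likelihood estimates
`f^k = (∑_{i<k} X_i / σ_i²) / (∑_{i<k} 1 / σ_i²)` converge almost surely to `μ`. -/
theorem stmt_11 {Ω : Type*} [MeasureSpace Ω] [IsProbabilityMeasure (ℙ : Measure Ω)]
    (μ : ℝ) (σmax : ℝ) (hσmax : 0 < σmax)
    (σ : ℕ → ℝ) (hσpos : ∀ i, 0 < σ i) (hσle : ∀ i, σ i ≤ σmax)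
    (X : ℕ → Ω → ℝ)
    (hindep : iIndepFun X ℙ)
    (hX : ∀ i, Measure.map (X i) ℙ = gaussianReal μ ⟨σ i ^ 2, sq_nonneg (σ i)⟩) :
    ℙ {ω : Ω | Tendsto
        (fun k => (∑ i ∈ Finset.range k, X i ω / σ i ^ 2)
            / (∑ i ∈ Finset.range k, 1 / σ i ^ 2))
        atTop (nhds μ)} = 1 := by
  have hX' : ∀ i, Measure.map (X i) ℙ = gaussianReal μ (NNReal.mk (σ i ^ 2) (sq_nonneg (σ i))) :=
    fun i => hX i
  have hm : ∀ i, AEMeasurable (X i) (ℙ : Measure Ω) := fun i =>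
    aemeasurable_of_map_neZero (by rw [hX' i]; infer_instance)
  let c : ℕ → NNReal := fun i => NNReal.mk (1 / σ i ^ 2) (by positivity)
  let Y : ℕ → Ω → ℝ := fun i ω => (σ i ^ 2)⁻¹ * (X i ω - μ)
  have hY : ∀ i, HasSubgaussianMGF (Y i) (c i) ℙ := by
    intro i
    apply aux_subG
    have h1 : HasLaw (X i) (gaussianReal μ (NNReal.mk (σ i ^ 2) (sq_nonneg (σ i)))) ℙ :=
      ⟨hm i, hX' i⟩
    have h2 := gaussianReal_const_mul (gaussianReal_sub_const h1 μ) (σ i ^ 2)⁻¹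
    convert h2 using 2
    · simp
    · have := (hσpos i).ne'
      ext
      simp only [c, NNReal.coe_mul, NNReal.coe_mk]
      field_simp
  have hYi : iIndepFun Y ℙ :=
    hindep.comp (fun i x => (σ i ^ 2)⁻¹ * (x - μ)) (fun i => by fun_prop)
  have hS : ∀ k, HasSubgaussianMGF (fun ω => ∑ i ∈ range k, Y i ω) (∑ i ∈ range k, c i) ℙ :=
    fun k => HasSubgaussianMGF.sum_of_iIndepFun hYi (fun i _ => hY i)
  have hN : ∀ k, HasSubgaussianMGF (-fun ω => ∑ i ∈ range k, Y i ω) (∑ i ∈ range k, c i) ℙ :=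
    fun k => (hS k).neg
  have ha : 0 < 1 / σmax ^ 2 := by positivity
  have hcs : ∀ k, ((∑ i ∈ range k, c i : NNReal) : ℝ) = ∑ i ∈ range k, 1 / σ i ^ 2 := by
    intro k
    rw [NNReal.coe_sum]
    rfl
  have hc : ∀ k : ℕ, k * (1 / σmax ^ 2) ≤ ((∑ i ∈ range k, c i : NNReal) : ℝ) := by
    intro k
    rw [hcs]
    have : ∑ i ∈ range k, 1 / σmax ^ 2 ≤ ∑ i ∈ range k, 1 / σ i ^ 2 := by
      refine Finset.sum_le_sum fun i _ => ?_
      have := hσpos i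
      have := hσle i
      gcongr
    simpa using this
  have hae : ∀ᵐ ω ∂(ℙ : Measure Ω), Tendsto
        (fun k => (∑ i ∈ Finset.range k, X i ω / σ i ^ 2)
            / (∑ i ∈ Finset.range k, 1 / σ i ^ 2)) atTop (nhds μ) := by
    have h1 := ae_all_iff.2 fun n : ℕ => aux_tail ha hS hc (ε := 1 / ((n : ℝ) + 1)) (by positivity)
    have h2 := ae_all_iff.2 fun n : ℕ => aux_tail ha hN hc (ε := 1 / ((n : ℝ) + 1)) (by positivity)
    filter_upwards [h1, h2] with ω h1 h2
    rw [Metric.tendsto_nhds]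
    intro ε hε
    obtain ⟨n, hn⟩ := exists_nat_one_div_lt hε
    filter_upwards [h1 n, h2 n, eventually_gt_atTop 0] with k hk1 hk2 hk
    have hkc := hc k
    rw [hcs] at hk1 hk2 hkc
    have hpos : 0 < ∑ i ∈ range k, 1 / σ i ^ 2 := lt_of_lt_of_le (by positivity) hkc
    have hYs : ∑ i ∈ range k, Y i ω
        = ∑ i ∈ range k, X i ω / σ i ^ 2 - μ * ∑ i ∈ range k, 1 / σ i ^ 2 := by
      rw [Finset.mul_sum, ← Finset.sum_sub_distrib]
      refine Finset.sum_congr rfl fun i _ => ?_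
      simp only [Y]
      ring
    simp only [Pi.neg_apply] at hk2
    rw [hYs] at hk1 hk2
    rw [Real.dist_eq]
    refine lt_trans ?_ hn
    have : (∑ i ∈ range k, X i ω / σ i ^ 2) / (∑ i ∈ range k, 1 / σ i ^ 2) - μ
        = (∑ i ∈ range k, X i ω / σ i ^ 2 - μ * ∑ i ∈ range k, 1 / σ i ^ 2)
          / (∑ i ∈ range k, 1 / σ i ^ 2) := by
      rw [sub_div, mul_div_assoc, div_self hpos.ne', mul_one]
    rw [this, abs_div, abs_of_pos hpos, div_lt_iff₀ hpos, abs_lt]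
    constructor <;> linarith
  rw [measure_congr (eventuallyEq_univ.2 hae), measure_univ]
end
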